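/- Let κ be a regular cardinal, let C be a locally κ-presentable category, and let K be a category with fewer than κ morphisms. Then there exists a regular cardinal π ≥ κ such that for every regular cardinal μ ≥ π and every functor F : K → C, the object F is μ-presentable in the functor category Fun(K, C) if and only if F(x) is μ-presentable in C for every object x of K. -/

import Mathlib

/-!
STATEMENT 5: Let κ be regular, C locally κ-presentable, and K a category with fewer
than κ morphisms. There exists a regular π ≥ κ such that for every regular μ ≥ π and
every functor F : K ⥤ C, F is μ-presentable in Fun(K, C) iff F(x) is μ-presentable in
C for every object x of K.
-/

universe v u

open CategoryTheory CategoryTheory.Limits Opposite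

namespace Reflection

def IsCardinalFiltered (J : Type u₂) [Category.{v₂} J] (κ : Cardinal.{v}) : Prop :=
  ∀ (A : Type v) [SmallCategory A],
    Cardinal.mk (Σ (a : A) (b : A), a ⟶ b) < κ →
      ∀ F : A ⥤ J, Nonempty (Cocone F)

def IsPresentableObj {C : Type u} [Category.{v} C] (κ : Cardinal.{v}) (X : C) : Prop :=
  ∀ (J : Type v) [SmallCategory J], IsCardinalFiltered J κ →
    ∀ (F : J ⥤ C) (c : Cocone F), IsColimit c →
      Nonempty (IsColimit ((coyoneda.obj (op X)).mapCocone c))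

def IsLocallyPresentable (C : Type u) [Category.{v} C] (κ : Cardinal.{v}) : Prop :=
  HasColimitsOfSize.{v, v} C ∧
    ∃ S : Set C, Small.{v} S ∧ (∀ X ∈ S, IsPresentableObj κ X) ∧
      ∀ X : C, ∃ (J : Type v) (_ : SmallCategory J) (F : J ⥤ C) (c : Cocone F),
        IsCardinalFiltered J κ ∧ (∀ j, F.obj j ∈ S) ∧
          Nonempty (IsColimit c) ∧ Nonempty (c.pt ≅ X)

lemma hasCardinalLT_arrow_iff {A : Type v} [SmallCategory A] {κ : Cardinal.{v}} :
    HasCardinalLT (Arrow A) κ ↔ Cardinal.mk (Σ (a : A) (b : A), a ⟶ b) < κ := by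
  rw [← hasCardinalLT_iff_cardinal_mk_lt]
  exact hasCardinalLT_iff_of_equiv
    { toFun := fun f ↦ ⟨f.left, f.right, f.hom⟩
      invFun := fun f ↦ Arrow.mk f.2.2
      left_inv := fun _ ↦ rfl
      right_inv := fun _ ↦ rfl } κ

section Accessibility

variable {C : Type u} [Category.{v} C] {κ : Cardinal.{v}} [Fact κ.IsRegular]

/-- A functor with `κ`-small domain and `κ`-presentable values is `κ`-presentable. -/
lemma isCardinalPresentable_functor {K : Type v} [SmallCategory K]
    [HasCardinalFilteredColimits C κ] (hK : HasCardinalLT (Arrow K) κ) (F : K ⥤ C)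
    [∀ x, IsCardinalPresentable (F.obj x) κ] : IsCardinalPresentable F κ where
  preservesColimitOfShape J _ _ := ⟨fun {G} ↦ ⟨fun {c} hc ↦ ⟨by
    have := isFiltered_of_isCardinalFiltered J κ
    have := HasCardinalFilteredColimits.hasColimitsOfShape C κ J
    have hK' : HasCardinalLT K κ := hasCardinalLT_of_hasCardinalLT_arrow hK
    have hcx (x : K) : IsColimit (((evaluation K C).obj x).mapCocone c) :=
      isColimitOfPreserves _ hc
    refine Types.FilteredColimit.isColimitOf' _ _ (fun (α : F ⟶ c.pt) ↦ ?_)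
      (fun j (α β : F ⟶ G.obj j) h ↦ ?_)
    · choose j f hf using fun x ↦
        IsCardinalPresentable.exists_hom_of_isColimit κ (hcx x) (α.app x)
      let m := IsCardinalFiltered.max j hK'
      obtain ⟨f', hf'⟩ : ∃ f' : ∀ x, F.obj x ⟶ (G.obj m).obj x,
          ∀ x, f' x ≫ (c.ι.app m).app x = α.app x :=
        ⟨fun x ↦ f x ≫ (G.map (IsCardinalFiltered.toMax j hK' x)).app x, fun x ↦ by
          rw [← hf x, Category.assoc, ← NatTrans.comp_app, c.w]
          rfl⟩
      have key (φ : Arrow K) : ∃ (k : J) (u : m ⟶ k),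
          (F.map φ.hom ≫ f' φ.right) ≫ (G.map u).app φ.right =
            (f' φ.left ≫ (G.obj m).map φ.hom) ≫ (G.map u).app φ.right :=
        IsCardinalPresentable.exists_eq_of_isColimit' κ (hcx φ.right) _ _ (by
          dsimp
          rw [Category.assoc, Category.assoc, hf', NatTrans.naturality,
            (c.ι.app m).naturality φ.hom, reassoc_of% (hf' φ.left)]
          rfl)
      choose k u hu using key
      obtain ⟨n, a, b, hab⟩ := IsCardinalFiltered.wideSpan u hK
      refine ⟨n, { app := fun x ↦ f' x ≫ (G.map b).app x, naturality := fun x y φ ↦ ?_ }, ?_⟩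
      · have := hu (Arrow.mk φ) =≫ (G.map (a (Arrow.mk φ))).app y
        rw [← hab (Arrow.mk φ)]
        simpa using this
      · refine NatTrans.ext (funext fun x ↦ ?_)
        change α.app x = (f' x ≫ (G.map b).app x) ≫ (c.ι.app n).app x
        rw [Category.assoc, ← NatTrans.comp_app, c.w, hf']
    · have key (x : K) : ∃ (k : J) (u : j ⟶ k),
          α.app x ≫ (G.map u).app x = β.app x ≫ (G.map u).app x :=
        IsCardinalPresentable.exists_eq_of_isColimit' κ (hcx x) _ _ (NatTrans.congr_app h x)
      choose k u hu using key
      obtain ⟨n, a, b, hab⟩ := IsCardinalFiltered.wideSpan u hK'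
      refine ⟨n, b, ?_⟩
      refine NatTrans.ext (funext fun x ↦ ?_)
      change α.app x ≫ (G.map b).app x = β.app x ≫ (G.map b).app x
      rw [← hab x, Functor.map_comp, NatTrans.comp_app, reassoc_of% (hu x)]⟩⟩⟩

section Dense

variable {D : Type v} [SmallCategory D] (A : D ⥤ C) [A.IsDense]

include A in
lemma hasLimits_of_isDense [HasColimitsOfSize.{v, v} C] : HasLimitsOfSize.{v, v} C := by
  let L := (uliftYoneda.{v} (C := D)).leftKanExtension A
  let adj : L ⊣ Presheaf.restrictedULiftYoneda.{v} A :=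
    Presheaf.uliftYonedaAdjunction.{v} L ((uliftYoneda.{v} (C := D)).leftKanExtensionUnit A)
  let : Reflective (Presheaf.restrictedULiftYoneda.{v} A) := ⟨_, adj⟩
  exact hasLimits_of_reflective (Presheaf.restrictedULiftYoneda.{v} A)

/-- Colimit cocones can be detected by a dense functor with small domain. -/
lemma nonempty_isColimit_of_isDense {J : Type v} [SmallCategory J] {G : J ⥤ C} (c : Cocone G)
    (h : ∀ d, Nonempty (IsColimit ((coyoneda.obj (op (A.obj d))).mapCocone c))) :
    Nonempty (IsColimit c) :=
  ⟨isColimitOfReflects (Presheaf.restrictedULiftYoneda.{v} A)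
    (evaluationJointlyReflectsColimits _ fun d ↦
      isColimitOfPreserves uliftFunctor.{v} (h d.unop).some)⟩

end Dense

/-- The cone exhibiting morphisms to a constant product as families of morphisms. -/
noncomputable def coyonedaProductCone {K : Type v} [SmallCategory K]
    [∀ a b : K, HasProductsOfShape (a ⟶ b) C] (x y : K) (M : C) :
    Cone (Discrete.functor fun _ : y ⟶ x ↦ coyoneda.obj (op M)) where
  pt := evaluationRightAdjoint C x ⋙ (evaluation K C).obj y ⋙ coyoneda.obj (op M)
  π := Discrete.natTrans fun g ↦
    { app := fun c ↦ ↾ fun f ↦ f ≫ Pi.π (fun _ : y ⟶ x ↦ c) g.as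
      naturality := fun c c' φ ↦ by
        ext f
        change (f ≫ Pi.lift fun g : y ⟶ x ↦ Pi.π (fun _ ↦ c) g ≫ φ) ≫ Pi.π (fun _ ↦ c') g.as =
          (f ≫ Pi.π (fun _ ↦ c) g.as) ≫ φ
        rw [Category.assoc, Pi.lift_π]
        exact (Category.assoc _ _ _).symm }

/-- Evaluating `coyonedaProductCone` at any object gives a limit cone. -/
noncomputable def isLimitCoyonedaProductCone {K : Type v} [SmallCategory K]
    [∀ a b : K, HasProductsOfShape (a ⟶ b) C] (x y : K) (M c : C) :
    IsLimit (((evaluation C (Type v)).obj c).mapCone (coyonedaProductCone x y M)) :=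
  Nonempty.some (by
    rw [Types.isLimit_iff]
    intro s hs
    refine ⟨Pi.lift fun g ↦ s ⟨g⟩, ?_, ?_⟩
    · rintro ⟨g⟩
      exact limit.lift_π _ _
    · intro t ht
      exact Limits.Pi.hom_ext _ _ fun g ↦
        (ht ⟨g⟩).trans (Pi.lift_π (fun g : y ⟶ x ↦ s ⟨g⟩) g).symm)

lemma isCardinalAccessible_evaluationRightAdjoint {K : Type v} [SmallCategory K]
    (hK : HasCardinalLT (Arrow K) κ) [HasCardinalFilteredColimits C κ]
    [∀ a b : K, HasProductsOfShape (a ⟶ b) C]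
    {D : Type v} [SmallCategory D] (A : D ⥤ C) [A.IsDense]
    [∀ d, IsCardinalPresentable (A.obj d) κ] (x : K) :
    (evaluationRightAdjoint C x).IsCardinalAccessible κ where
  preservesColimitOfShape J _ _ := ⟨fun {G} ↦ ⟨fun {c} hc ↦ ⟨
    evaluationJointlyReflectsColimits _ fun y ↦ Nonempty.some <|
      nonempty_isColimit_of_isDense A _ fun d ↦ by
        have hd : IsColimit ((coyoneda.obj (op (A.obj d))).mapCocone c) :=
          have := preservesColimitsOfShape_of_isCardinalPresentable (A.obj d) κ J
          isColimitOfPreserves _ hc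
        have hyx : HasCardinalLT (y ⟶ x) κ :=
          hK.of_injective (fun f ↦ Arrow.mk f) fun f g h ↦ Arrow.mk_inj _ _ |>.1 h
        exact ⟨Functor.Accessible.Limits.isColimitMapCocone (coyonedaProductCone x y (A.obj d))
          (isLimitCoyonedaProductCone x y _) κ (by simpa using hyx) c fun _ ↦ hd⟩⟩⟩⟩

lemma isCardinalFiltered_iff {J : Type v} [SmallCategory J] :
    IsCardinalFiltered J κ ↔ CategoryTheory.IsCardinalFiltered J κ :=
  ⟨fun h ↦ ⟨fun F hA ↦ h _ (hasCardinalLT_arrow_iff.1 hA) F⟩,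
    fun h _ _ hA F ↦ h.nonempty_cocone F (hasCardinalLT_arrow_iff.2 hA)⟩

lemma isPresentableObj_iff (X : C) : IsPresentableObj κ X ↔ IsCardinalPresentable X κ :=
  ⟨fun h ↦ ⟨fun J _ hJ ↦ ⟨fun {F} ↦ ⟨fun {c} hc ↦ h J (isCardinalFiltered_iff.2 hJ) F c hc⟩⟩⟩,
    fun _ J _ hJ F c hc ↦ by
      have := isCardinalFiltered_iff.1 hJ
      have := preservesColimitsOfShape_of_isCardinalPresentable X κ J
      exact ⟨isColimitOfPreserves _ hc⟩⟩

lemma IsLocallyPresentable.isCardinalLocallyPresentable (h : IsLocallyPresentable C κ) :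
    IsCardinalLocallyPresentable C κ := by
  obtain ⟨_, S, hS, hS₁, hS₂⟩ := h
  let P : ObjectProperty C := fun X ↦ X ∈ S
  have : ObjectProperty.Small.{v} P := hS
  have hP : P.IsCardinalFilteredGenerator κ :=
    { le_isCardinalPresentable := fun X hX ↦ (isPresentableObj_iff X).1 (hS₁ X hX)
      exists_colimitsOfShape := fun X ↦ by
        obtain ⟨J, _, F, c, hJ, hF, ⟨hc⟩, ⟨e⟩⟩ := hS₂ X
        exact ⟨J, inferInstance, isCardinalFiltered_iff.1 hJ,
          ObjectProperty.prop_of_iso _ e ⟨{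
            diag := F
            ι := c.ι
            isColimit := hc
            prop_diag_obj := hF }⟩⟩ }
  have := hP.hasCardinalFilteredGenerator
  constructor

end Accessibility

theorem presentable_in_functor_category
    {C : Type u} [Category.{v} C] (κ : Cardinal.{v}) (hκ : κ.IsRegular)
    (hC : IsLocallyPresentable C κ)
    (K : Type v) [SmallCategory K]
    (hK : Cardinal.mk (Σ (a : K) (b : K), a ⟶ b) < κ) :
    ∃ π : Cardinal.{v}, π.IsRegular ∧ κ ≤ π ∧
      ∀ μ : Cardinal.{v}, μ.IsRegular → π ≤ μ →
        ∀ F : K ⥤ C,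
          (IsPresentableObj μ (C := K ⥤ C) F ↔ ∀ x : K, IsPresentableObj μ (F.obj x)) := by
  have : Fact κ.IsRegular := ⟨hκ⟩
  have := hC.isCardinalLocallyPresentable
  refine ⟨κ, hκ, le_rfl, fun μ hμ hκμ F ↦ ?_⟩
  have : Fact μ.IsRegular := ⟨hμ⟩
  have hKμ : HasCardinalLT (Arrow K) μ := (hasCardinalLT_arrow_iff.2 hK).of_le hκμ
  simp only [isPresentableObj_iff]
  refine ⟨fun _ x ↦ ?_, fun _ ↦ isCardinalPresentable_functor hKμ F⟩
  let P := isCardinalPresentable C κ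
  let A : SmallModel.{v} P.FullSubcategory ⥤ C := (equivSmallModel _).inverse ⋙ P.ι
  have : HasLimitsOfSize.{v, v} C := hasLimits_of_isDense A
  have hA (d) : IsCardinalPresentable (A.obj d) μ :=
    have : IsCardinalPresentable (A.obj d) κ := ((equivSmallModel _).inverse.obj d).property
    isCardinalPresentable_of_le _ hκμ
  have := isCardinalAccessible_evaluationRightAdjoint hKμ A x
  exact (evaluationAdjunctionLeft C x).isCardinalPresentable_leftAdjoint_obj μ F

end Reflection
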